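/- Let R = ℝ[x₁,…,xₙ], fix m ≥ 1 and natural numbers α₁,…,α_m, and let Λ be a symmetric m×m matrix with entries in R that is homogeneous of some degree D and positive definite. Then there exists k ∈ ℕ such that R_{≥k} ⊆ (Σ(Λ) : R^m), i.e. a·u ∈ Σ(Λ) for every a ∈ R_{≥k} and every u ∈ R^m. -/

import Mathlib

open MvPolynomial

/-- `q` is a sum of squares of polynomials. -/
def IsSOS {n : ℕ} (q : MvPolynomial (Fin n) ℝ) : Prop :=
  ∃ (s : ℕ) (g : Fin s → MvPolynomial (Fin n) ℝ), q = ∑ i, (g i) ^ 2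

/-- A vector `v ∈ R^m` is homogeneous of degree `k` (for the twists `α₁,…,α_m`) if its
`i`-th coordinate is homogeneous of degree `k − αᵢ`, and zero whenever `k < αᵢ`. -/
def IsVHomog {n m : ℕ} (α : Fin m → ℕ) (k : ℕ)
    (v : Fin m → MvPolynomial (Fin n) ℝ) : Prop :=
  ∀ i, ((v i).IsHomogeneous (k - α i) ∧ (k < α i → v i = 0))

/-- A symmetric `m×m` matrix `Λ` over `R` is homogeneous of degree `D` (for the twists
`α₁,…,α_m`) if its `(i,j)` entry is homogeneous of degree `D − αᵢ − αⱼ`, and zero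
whenever `D < αᵢ + αⱼ`. -/
def IsMatHomog {n m : ℕ} (α : Fin m → ℕ) (D : ℕ)
    (Λ : Matrix (Fin m) (Fin m) (MvPolynomial (Fin n) ℝ)) : Prop :=
  ∀ i j, ((Λ i j).IsHomogeneous (D - α i - α j) ∧ (D < α i + α j → Λ i j = 0))

/-- `Σ(Λ)`: the `R`-submodule of `R^m` generated by all homogeneous vectors `v` such that
`q·Λ = v·vᵀ + w₁·w₁ᵀ + … + w_s·w_sᵀ` for some homogeneous sum of squares `q ∈ R` and
vectors `w₁,…,w_s ∈ R^m`. -/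
noncomputable def SigmaMod {n m : ℕ} (α : Fin m → ℕ)
    (Λ : Matrix (Fin m) (Fin m) (MvPolynomial (Fin n) ℝ)) :
    Submodule (MvPolynomial (Fin n) ℝ) (Fin m → MvPolynomial (Fin n) ℝ) :=
  Submodule.span _ {v | (∃ k, IsVHomog α k v) ∧
    ∃ (q : MvPolynomial (Fin n) ℝ) (dq : ℕ), IsSOS q ∧ q.IsHomogeneous dq ∧
      ∃ (s : ℕ) (w : Fin s → (Fin m → MvPolynomial (Fin n) ℝ)),
        q • Λ = Matrix.vecMulVec v v + ∑ l, Matrix.vecMulVec (w l) (w l)}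

section Polya

variable {τ ι : Type*} [Fintype τ] [Fintype ι]

/-- Evaluation of a polynomial where every power `z ^ g` is replaced by the falling power
`z (z - h) (z - 2 h) ⋯ (z - (g - 1) h)` of step `h`. -/
noncomputable def fallingEval (h : ℝ) (z : τ → ℝ) (p : MvPolynomial τ ℝ) : ℝ :=
  ∑ g ∈ p.support, coeff g p * ∏ t, ∏ k ∈ Finset.range (g t), (z t - k * h)

lemma fallingEval_zero (z : τ → ℝ) (p : MvPolynomial τ ℝ) : fallingEval 0 z p = eval z p := by
  simp [fallingEval, eval_eq', Finset.prod_const]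

lemma continuous_fallingEval (p : MvPolynomial τ ℝ) :
    Continuous fun x : ℝ × (τ → ℝ) => fallingEval x.1 x.2 p := by
  unfold fallingEval
  fun_prop

lemma cast_descFactorial_eq_prod (b g : ℕ) :
    (b.descFactorial g : ℝ) = ∏ k ∈ Finset.range g, ((b : ℝ) - k) := by
  induction g with
  | zero => simp
  | succ g ih =>
    rw [Nat.descFactorial_succ, Finset.prod_range_succ, ← ih]
    rcases le_or_gt g b with h | h
    · push_cast [Nat.cast_sub h]; ring
    · simp [Nat.descFactorial_eq_zero_iff_lt.mpr h]

lemma prod_descFactorial_eq_smul (b g : τ →₀ ℕ) {M : ℝ} (hM : M ≠ 0) :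
    ((∏ t, (b t).descFactorial (g t) : ℕ) : ℝ) =
      M ^ g.degree * ∏ t, ∏ k ∈ Finset.range (g t), ((b t : ℝ) / M - k * (1 / M)) := by
  rw [Finsupp.degree_eq_sum, ← Finset.prod_pow_eq_pow_sum, ← Finset.prod_mul_distrib]
  push_cast
  refine Finset.prod_congr rfl fun t _ => ?_
  rw [cast_descFactorial_eq_prod]
  have : M ^ g t = ∏ _k ∈ Finset.range (g t), M := by simp
  rw [this, ← Finset.prod_mul_distrib]
  refine Finset.prod_congr rfl fun k _ => ?_
  field_simp

/-- The coefficients of `(∑ t, X t) ^ N` times a monomial in terms of falling factorials. -/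
lemma coeff_sum_X_pow_mul_monomial (N : ℕ) (b g : τ →₀ ℕ) (c : ℝ) (hb : b.degree = N + g.degree) :
    coeff b ((∑ t, X t) ^ N * monomial g c) =
      (N.factorial : ℝ) / (∏ t, ((b t).factorial : ℝ)) *
        (c * ((∏ t, (b t).descFactorial (g t) : ℕ) : ℝ)) := by
  classical
  rw [coeff_mul_monomial']
  split_ifs with h
  · obtain ⟨d, rfl⟩ := exists_add_of_le h
    have hd : d.degree = N := by
      rw [map_add] at hb; omega
    have hd' : (d.sum fun _ m => m) = N := hd
    rw [add_tsub_cancel_left, coeff_sum_X_pow_of_fintype, if_pos hd',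
      Finsupp.multinomial_eq_of_support_subset (Finset.subset_univ _)]
    have h1 := Nat.multinomial_spec Finset.univ d
    rw [← Finsupp.degree_eq_sum, hd] at h1
    have h2 : (∏ t, (d t).factorial) * ∏ t, ((g + d) t).descFactorial (g t) =
        ∏ t, ((g + d) t).factorial := by
      rw [← Finset.prod_mul_distrib]
      refine Finset.prod_congr rfl fun t _ => ?_
      have := Nat.factorial_mul_descFactorial (n := (g + d) t) (k := g t) (by simp)
      simpa using this
    have h0 : ((∏ t, (d t).factorial : ℕ) : ℝ) ≠ 0 := by
      exact_mod_cast Finset.prod_ne_zero_iff.mpr fun t _ => Nat.factorial_ne_zero _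
    have h3 : (∏ t, (((g + d) t).factorial : ℝ)) ≠ 0 :=
      Finset.prod_ne_zero_iff.mpr fun t _ => by exact_mod_cast Nat.factorial_ne_zero _
    have h2' := congrArg (Nat.cast : ℕ → ℝ) h2
    have h1' := congrArg (Nat.cast : ℕ → ℝ) h1
    rw [Nat.cast_mul] at h1' h2'
    rw [Nat.cast_prod (fun t => ((g + d) t).factorial)] at h2'
    rw [← h1', ← h2']
    rw [← h2'] at h3
    have h4 := right_ne_zero_of_mul h3
    field_simp
  · have : ∃ t, b t < g t := by
      by_contra! h'
      exact h h'
    obtain ⟨t, ht⟩ := this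
    have h0 : ∏ t, (b t).descFactorial (g t) = 0 :=
      Finset.prod_eq_zero (Finset.mem_univ t) (Nat.descFactorial_eq_zero_iff_lt.mpr ht)
    simp [h0]

lemma coeff_sum_X_pow_mul {N e : ℕ} {p : MvPolynomial τ ℝ} (hp : p.IsHomogeneous e)
    {b : τ →₀ ℕ} (hb : b.degree = N + e) (hN : N + e ≠ 0) :
    coeff b ((∑ t, X t) ^ N * p) =
      (N.factorial : ℝ) / (∏ t, ((b t).factorial : ℝ)) * ((N + e : ℕ) : ℝ) ^ e *
        fallingEval (1 / ((N + e : ℕ) : ℝ)) (fun t => (b t : ℝ) / ((N + e : ℕ) : ℝ)) p := by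
  conv_lhs => rw [← p.support_sum_monomial_coeff]
  rw [Finset.mul_sum, coeff_sum, fallingEval, Finset.mul_sum]
  refine Finset.sum_congr rfl fun g hg => ?_
  have hge : g.degree = e := (hp.degree_eq_sum_deg_support hg).symm
  rw [coeff_sum_X_pow_mul_monomial N b g _ (by rw [hb, hge]),
    prod_descFactorial_eq_smul b g (M := ((N + e : ℕ) : ℝ)) (by exact_mod_cast hN), hge]
  ring

lemma dotProduct_mulVec_eq_sum {R : Type*} [CommSemiring R] (A : Matrix ι ι R) (x : ι → R) :
    x ⬝ᵥ A.mulVec x = ∑ i, ∑ j, x i * A i j * x j := by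
  simp [dotProduct, Matrix.mulVec, Finset.mul_sum, mul_assoc]

lemma isCompact_sum_sq_eq (r : ℝ) : IsCompact {x : ι → ℝ | ∑ i, x i ^ 2 = r} := by
  refine Metric.isCompact_of_isClosed_isBounded
    (isClosed_eq (by fun_prop) continuous_const) ?_
  refine (Metric.isBounded_closedBall (x := (0 : ι → ℝ)) (r := Real.sqrt r)).subset fun x hx => ?_
  rw [mem_closedBall_zero_iff, pi_norm_le_iff_of_nonneg (Real.sqrt_nonneg _)]
  intro i
  refine Real.abs_le_sqrt ?_
  rw [← Set.mem_ofPred_eq.mp hx]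
  exact Finset.single_le_sum (f := fun i => x i ^ 2) (fun i _ => sq_nonneg _) (Finset.mem_univ i)

lemma quadForm_pos_of_unit {A : Matrix ι ι ℝ}
    (h : ∀ x : ι → ℝ, ∑ i, x i ^ 2 = 1 → 0 < x ⬝ᵥ A.mulVec x) {x : ι → ℝ} (hx : x ≠ 0) :
    0 < x ⬝ᵥ A.mulVec x := by
  have hs : 0 < ∑ i, x i ^ 2 := by
    obtain ⟨i, hi⟩ := Function.ne_iff.mp hx
    exact Finset.sum_pos' (fun i _ => sq_nonneg _) ⟨i, Finset.mem_univ _, by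
      have : x i ≠ 0 := hi
      positivity⟩
  set s := Real.sqrt (∑ i, x i ^ 2) with hsdef
  have hs0 : 0 < s := Real.sqrt_pos.mpr hs
  have hs2 : s ^ 2 = ∑ i, x i ^ 2 := Real.sq_sqrt hs.le
  have := h (s⁻¹ • x) (by
    simp only [Pi.smul_apply, smul_eq_mul, mul_pow, ← Finset.mul_sum, ← hs2]
    field_simp)
  rw [Matrix.mulVec_smul, smul_dotProduct, dotProduct_smul, smul_eq_mul, smul_eq_mul] at this
  have h3 : 0 < s⁻¹ := by positivity
  exact pos_of_mul_pos_right (pos_of_mul_pos_right this h3.le) h3.le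

/-- **Pólya's theorem** for matrices of forms. -/
theorem exists_posSemidef_coeff_of_pos_on_stdSimplex {e : ℕ}
    (P : Matrix ι ι (MvPolynomial τ ℝ)) (hsymm : P.IsSymm) (hP : ∀ i j, (P i j).IsHomogeneous e)
    (hpos : ∀ z ∈ stdSimplex ℝ τ, ∀ x : ι → ℝ, x ≠ 0 →
      0 < x ⬝ᵥ (P.map (eval z)).mulVec x) :
    ∃ N : ℕ, ∀ b : τ →₀ ℕ,
      ((((∑ t, X t : MvPolynomial τ ℝ) ^ N) • P).map (coeff b)).PosSemidef := by
  have hK : IsCompact (stdSimplex ℝ τ ×ˢ {x : ι → ℝ | ∑ i, x i ^ 2 = 1}) :=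
    (isCompact_stdSimplex ℝ τ).prod (isCompact_sum_sq_eq 1)
  have hcont : Continuous fun w : ℝ × ((τ → ℝ) × (ι → ℝ)) =>
      w.2.2 ⬝ᵥ (P.map (fallingEval w.1 w.2.1)).mulVec w.2.2 := by
    simp only [dotProduct_mulVec_eq_sum, Matrix.map_apply]
    refine continuous_finsetSum _ fun i _ => continuous_finsetSum _ fun j _ => ?_
    have := (continuous_fallingEval (P i j)).comp
      (continuous_fst.prodMk (continuous_fst.comp continuous_snd) :
        Continuous fun w : ℝ × ((τ → ℝ) × (ι → ℝ)) => (w.1, w.2.1))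
    simp only [Function.comp_def] at this
    fun_prop
  have hev : ∀ᶠ h : ℝ in nhds 0, ∀ y ∈ stdSimplex ℝ τ ×ˢ {x : ι → ℝ | ∑ i, x i ^ 2 = 1},
      0 < y.2 ⬝ᵥ (P.map (fallingEval h y.1)).mulVec y.2 := by
    refine hK.eventually_forall_of_forall_eventually fun y hy => ?_
    refine hcont.continuousAt.eventually_const_lt ?_
    have h0 : (P.map (fallingEval 0 y.1)) = P.map (eval y.1) := by
      ext i j; simp [fallingEval_zero]
    simp only [h0]
    refine hpos _ hy.1 _ ?_
    rintro h
    have := hy.2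
    simp [h] at this
  have hlim : Filter.Tendsto (fun N : ℕ => 1 / ((N + e : ℕ) : ℝ)) Filter.atTop (nhds 0) :=
    tendsto_one_div_atTop_nhds_zero_nat.comp (Filter.tendsto_add_atTop_nat e)
  obtain ⟨N, hN, hN1⟩ := ((hlim.eventually hev).and (Filter.eventually_ge_atTop 1)).exists
  refine ⟨N, fun b => ?_⟩
  have hM : N + e ≠ 0 := by omega
  have hherm : ((((∑ t, X t : MvPolynomial τ ℝ) ^ N) • P).map (coeff b)).IsHermitian := by
    ext i j
    simp [hsymm.apply i j]
  refine Matrix.PosSemidef.of_dotProduct_mulVec_nonneg hherm fun x => ?_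
  rw [star_trivial]
  by_cases hb : b.degree = N + e
  · set M : ℝ := ((N + e : ℕ) : ℝ) with hMdef
    have hM0 : 0 < M := by rw [hMdef]; exact_mod_cast Nat.pos_of_ne_zero hM
    have heq : (((∑ t, X t : MvPolynomial τ ℝ) ^ N) • P).map (coeff b) =
        ((N.factorial : ℝ) / (∏ t, ((b t).factorial : ℝ)) * M ^ e) •
          P.map (fallingEval (1 / M) (fun t => (b t : ℝ) / M)) := by
      ext i j
      simp only [Matrix.map_apply, Matrix.smul_apply, smul_eq_mul]
      rw [coeff_sum_X_pow_mul (hP i j) hb hM]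
    rw [heq, Matrix.smul_mulVec, dotProduct_smul, smul_eq_mul]
    refine mul_nonneg (by positivity) ?_
    by_cases hx : x = 0
    · simp [hx]
    refine (quadForm_pos_of_unit (fun x hx => ?_) hx).le
    refine hN (_, x) ⟨⟨fun t => by positivity, ?_⟩, hx⟩
    rw [← Finset.sum_div, div_eq_one_iff_eq hM0.ne', hMdef, ← hb, Finsupp.degree_eq_sum]
    push_cast
    rfl
  · have heq : (((∑ t, X t : MvPolynomial τ ℝ) ^ N) • P).map (coeff b) = 0 := by
      ext i j
      have h1 : (∑ t, X t : MvPolynomial τ ℝ).IsHomogeneous 1 :=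
        IsHomogeneous.sum _ _ _ fun t _ => isHomogeneous_X _ _
      have h2 := ((h1.pow N).mul (hP i j)).coeff_eq_zero (d := b) (by simpa using hb)
      simpa using h2
    simp [heq]

end Polya

section SquaresCone

variable {ι κ R : Type*} [CommRing R]

/-- The cone of sums of the matrices `w wᵀ`. -/
def sosCone (ι R : Type*) [CommRing R] : AddSubmonoid (Matrix ι ι R) :=
  AddSubmonoid.closure (Set.range fun w : ι → R => Matrix.vecMulVec w w)

lemma vecMulVec_mem_sosCone (w : ι → R) : Matrix.vecMulVec w w ∈ sosCone ι R :=
  AddSubmonoid.subset_closure ⟨w, rfl⟩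

lemma exists_eq_sum_of_mem_sosCone {A : Matrix ι ι R} (hA : A ∈ sosCone ι R) :
    ∃ (s : ℕ) (w : Fin s → ι → R), A = ∑ l, Matrix.vecMulVec (w l) (w l) := by
  induction hA using AddSubmonoid.closure_induction with
  | mem A h =>
    obtain ⟨w, rfl⟩ := h
    exact ⟨1, fun _ => w, by simp⟩
  | zero => exact ⟨0, Fin.elim0, by simp⟩
  | add A B _ _ hA hB =>
    obtain ⟨s, w, rfl⟩ := hA
    obtain ⟨t, v, rfl⟩ := hB
    exact ⟨s + t, Fin.append w v, by simp [Fin.sum_univ_add]⟩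

lemma transpose_mul_mul_mem_sosCone [Fintype ι] {A : Matrix ι ι R} (hA : A ∈ sosCone ι R)
    (B : Matrix ι κ R) : B.transpose * A * B ∈ sosCone κ R := by
  induction hA using AddSubmonoid.closure_induction with
  | mem A h =>
    obtain ⟨w, rfl⟩ := h
    simp only [Matrix.mul_vecMulVec, Matrix.vecMulVec_mul, Matrix.mulVec_transpose]
    exact vecMulVec_mem_sosCone _
  | zero => simp
  | add A B _ _ hA hB =>
    rw [Matrix.mul_add, Matrix.add_mul]
    exact add_mem hA hB

lemma sq_smul_mem_sosCone {A : Matrix ι ι R} (hA : A ∈ sosCone ι R) (r : R) :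
    r ^ 2 • A ∈ sosCone ι R := by
  induction hA using AddSubmonoid.closure_induction with
  | mem A h =>
    obtain ⟨w, rfl⟩ := h
    have : r ^ 2 • Matrix.vecMulVec w w = Matrix.vecMulVec (r • w) (r • w) := by
      ext i j; simp [Matrix.vecMulVec_apply]; ring
    rw [this]
    exact vecMulVec_mem_sosCone _
  | zero => simp
  | add A B _ _ hA hB =>
    rw [smul_add]
    exact add_mem hA hB

lemma C_smul_mem_sosCone {σ : Type*} {A : Matrix ι ι (MvPolynomial σ ℝ)}
    (hA : A ∈ sosCone ι (MvPolynomial σ ℝ)) {c : ℝ} (hc : 0 ≤ c) :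
    (C c : MvPolynomial σ ℝ) • A ∈ sosCone ι (MvPolynomial σ ℝ) := by
  have := sq_smul_mem_sosCone hA (C (Real.sqrt c))
  rwa [← C_pow, Real.sq_sqrt hc] at this

lemma map_C_mem_sosCone {σ : Type*} [Finite ι] {G : Matrix ι ι ℝ} (hG : G.PosSemidef) :
    G.map (C : ℝ →+* MvPolynomial σ ℝ) ∈ sosCone ι (MvPolynomial σ ℝ) := by
  obtain ⟨s, v, rfl⟩ := Matrix.posSemidef_iff_eq_sum_vecMulVec.mp hG
  have : (∑ i, Matrix.vecMulVec (v i) (star (v i))).map (C : ℝ →+* MvPolynomial σ ℝ) =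
      ∑ l, Matrix.vecMulVec (fun i => C (v l i)) (fun i => C (v l i)) := by
    ext i j : 1
    simp [Matrix.sum_apply, Matrix.vecMulVec_apply]
  rw [this]
  exact sum_mem fun l _ => vecMulVec_mem_sosCone _

/-- Substituting squares into a matrix polynomial with positive semidefinite coefficients
gives a sum of squares. -/
lemma map_aeval_sq_mem_sosCone {σ τ : Type*} [Fintype ι] {Q : Matrix ι ι (MvPolynomial τ ℝ)}
    (hQ : ∀ b, (Q.map (coeff b)).PosSemidef) (f : τ → MvPolynomial σ ℝ) :
    Q.map (aeval fun t => f t ^ 2) ∈ sosCone ι (MvPolynomial σ ℝ) := by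
  classical
  set S : Finset (τ →₀ ℕ) := Finset.univ.biUnion fun i => Finset.univ.biUnion fun j =>
    (Q i j).support
  have : Q.map (aeval fun t => f t ^ 2) =
      ∑ b ∈ S, (b.prod fun t k => f t ^ k) ^ 2 •
        (Q.map (coeff b)).map (C : ℝ →+* MvPolynomial σ ℝ) := by
    ext i j : 1
    simp only [Matrix.map_apply, Matrix.sum_apply, Matrix.smul_apply, smul_eq_mul]
    rw [aeval_def, eval₂_eq]
    refine Finset.sum_subset_zero_on_sdiff (s₁ := (Q i j).support) (s₂ := S) ?_ ?_ ?_
    · intro b hb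
      simp only [S, Finset.mem_biUnion, Finset.mem_univ, true_and]
      exact ⟨i, j, hb⟩
    · intro b hb
      have := notMem_support_iff.mp (Finset.mem_sdiff.mp hb).2
      simp [this]
    · intro b _
      rw [mul_comm, Finsupp.prod, ← Finset.prod_pow]
      simp [← pow_mul, mul_comm, algebraMap_eq]
  rw [this]
  exact sum_mem fun b _ => sq_smul_mem_sosCone (map_C_mem_sosCone (hQ b)) _

end SquaresCone

/-- If `f > 0` wherever the nonnegative function `g` vanishes on a compact set, then
`f + c g > 0` on that set for some `c ≥ 0`. -/
lemma IsCompact.exists_forall_pos_add_mul {E : Type*} [TopologicalSpace E] {K : Set E}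
    (hK : IsCompact K) {f g : E → ℝ} (hf : Continuous f) (hg : Continuous g)
    (hg0 : ∀ x ∈ K, 0 ≤ g x) (h : ∀ x ∈ K, g x = 0 → 0 < f x) :
    ∃ c : ℝ, 0 ≤ c ∧ ∀ x ∈ K, 0 < f x + c * g x := by
  obtain ⟨m, hm⟩ := hK.elim_directed_cover (fun k : ℕ => {x | 0 < f x + k * max (g x) 0})
    (fun k => isOpen_lt continuous_const (by fun_prop))
    (fun x hx => by
      rcases (hg0 x hx).eq_or_lt with h0 | h0
      · exact Set.mem_iUnion.mpr ⟨0, by simpa using h x hx h0.symm⟩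
      · obtain ⟨k, hk⟩ := exists_nat_gt (-f x / g x)
        refine Set.mem_iUnion.mpr ⟨k, ?_⟩
        rw [div_lt_iff₀ h0] at hk
        rw [Set.mem_ofPred_eq, max_eq_left h0.le]
        linarith)
    (directed_of_isDirected_le fun a b hab x hx => by
      have hab' : (a : ℝ) ≤ b := by exact_mod_cast hab
      have := mul_le_mul_of_nonneg_right hab' (le_max_right (g x) 0)
      simp only [Set.mem_ofPred_eq] at hx ⊢
      linarith)
  refine ⟨m, m.cast_nonneg, fun x hx => ?_⟩
  have := hm hx
  rwa [Set.mem_ofPred_eq, max_eq_left (hg0 x hx)] at this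

section Veronese

variable (n : ℕ)

/-- The form `x₁² + … + xₙ²`. -/
noncomputable def sumSqX : MvPolynomial (Fin n) ℝ := ∑ i, X i ^ 2

variable {n}

lemma isHomogeneous_sumSqX : (sumSqX n).IsHomogeneous 2 :=
  IsHomogeneous.sum _ _ _ fun i _ => isHomogeneous_X_pow i 2

lemma eval_sumSqX (p : Fin n → ℝ) : eval p (sumSqX n) = ∑ i, p i ^ 2 := by
  simp [sumSqX]

/-- The linear forms `xᵢ + xⱼ` and `xᵢ - xⱼ`. -/
noncomputable def pairForm (t : Fin n × Fin n × Bool) : MvPolynomial (Fin n) ℝ :=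
  bif t.2.2 then X t.1 + X t.2.1 else X t.1 - X t.2.1

/-- The substitution of the squares `(xᵢ ± xⱼ)²` for the variables. -/
noncomputable def pairSq : MvPolynomial (Fin n × Fin n × Bool) ℝ →ₐ[ℝ] MvPolynomial (Fin n) ℝ :=
  aeval fun t => pairForm t ^ 2

/-- A linear form which `pairSq` sends to `xᵢ xⱼ`. -/
noncomputable def prodForm (i j : Fin n) : MvPolynomial (Fin n × Fin n × Bool) ℝ :=
  C (1 / 4) * (X (i, j, true) - X (i, j, false))

lemma isHomogeneous_prodForm (i j : Fin n) : (prodForm i j).IsHomogeneous 1 :=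
  ((isHomogeneous_X _ _).sub (isHomogeneous_X _ _)).C_mul _

lemma pairSq_prodForm (i j : Fin n) : pairSq (prodForm i j) = X i * X j := by
  have h : (C (1 / 4) : MvPolynomial (Fin n) ℝ) * 4 = 1 := by
    rw [← map_ofNat (C : ℝ →+* MvPolynomial (Fin n) ℝ), ← C_mul]; norm_num
  simp only [pairSq, prodForm, pairForm, map_mul, map_sub, aeval_X, algHom_C, algebraMap_eq,
    cond_true, cond_false]
  linear_combination (X i * X j) * h

lemma pairSq_sum_X : pairSq (∑ t, X t) = C (4 * n : ℝ) * sumSqX n := by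
  simp only [pairSq, pairForm, map_sum, map_add, aeval_X, Fintype.sum_prod_type, Fintype.sum_bool,
    cond_true, cond_false, sumSqX]
  have h : ∀ i j : Fin n, (X i + X j : MvPolynomial (Fin n) ℝ) ^ 2 + (X i - X j) ^ 2 =
      2 * X i ^ 2 + 2 * X j ^ 2 := fun i j => by ring
  simp only [h, Finset.sum_add_distrib, ← Finset.mul_sum, Finset.sum_const, Finset.card_univ,
    Fintype.card_fin, nsmul_eq_mul]
  simp only [map_mul, map_ofNat, map_natCast]
  ring

lemma exists_monomial_eq_X_mul (s : Fin n →₀ ℕ) {k : ℕ} (hs : s.degree = k + 1) :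
    ∃ i s', s'.degree = k ∧ (monomial s 1 : MvPolynomial (Fin n) ℝ) = X i * monomial s' 1 := by
  have : s ≠ 0 := by rintro rfl; simp at hs
  obtain ⟨i, hi⟩ := Finsupp.ne_iff.mp this
  have hle : Finsupp.single i 1 ≤ s :=
    Finsupp.single_le_iff.mpr (Nat.one_le_iff_ne_zero.mpr hi)
  obtain ⟨s', rfl⟩ := exists_add_of_le hle
  refine ⟨i, s', ?_, by simp [X, monomial_mul]⟩
  rw [map_add, Finsupp.degree_single] at hs
  omega

lemma exists_pairSq_eq_monomial (d : ℕ) : ∀ s : Fin n →₀ ℕ, s.degree = 2 * d →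
    ∃ P : MvPolynomial (Fin n × Fin n × Bool) ℝ, P.IsHomogeneous d ∧
      pairSq P = monomial s 1 := by
  induction d with
  | zero =>
    intro s hs
    have : s = 0 := (Finsupp.degree_eq_zero_iff s).mp (by simpa using hs)
    exact ⟨1, isHomogeneous_one _ _, by simp [this]⟩
  | succ d ih =>
    intro s hs
    obtain ⟨i, s₁, hs₁, h₁⟩ := exists_monomial_eq_X_mul s (k := 2 * d + 1) (by omega)
    obtain ⟨j, s₂, hs₂, h₂⟩ := exists_monomial_eq_X_mul s₁ hs₁
    obtain ⟨P, hP, hPs⟩ := ih s₂ hs₂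
    refine ⟨P * prodForm i j, hP.mul (isHomogeneous_prodForm i j), ?_⟩
    rw [map_mul, hPs, pairSq_prodForm, h₁, h₂]
    ring

lemma exists_pairSq_eq {d : ℕ} {f : MvPolynomial (Fin n) ℝ} (hf : f.IsHomogeneous (2 * d)) :
    ∃ P : MvPolynomial (Fin n × Fin n × Bool) ℝ, P.IsHomogeneous d ∧ pairSq P = f := by
  have h : ∀ s : Fin n →₀ ℕ, ∃ P : MvPolynomial (Fin n × Fin n × Bool) ℝ, P.IsHomogeneous d ∧
      (s.degree = 2 * d → pairSq P = monomial s 1) := by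
    intro s
    by_cases hs : s.degree = 2 * d
    · obtain ⟨P, hP, h⟩ := exists_pairSq_eq_monomial d s hs
      exact ⟨P, hP, fun _ => h⟩
    · exact ⟨0, isHomogeneous_zero _ _ _, fun h => absurd h hs⟩
  choose P hP hPs using h
  refine ⟨∑ s ∈ f.support, C (coeff s f) * P s,
    IsHomogeneous.sum _ _ _ fun s _ => (hP s).C_mul _, ?_⟩
  conv_rhs => rw [← f.support_sum_monomial_coeff]
  rw [map_sum]
  refine Finset.sum_congr rfl fun s hs => ?_
  rw [map_mul, hPs s (hf.degree_eq_sum_deg_support hs).symm, algHom_C, algebraMap_eq,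
    C_mul_monomial, mul_one]

/-- A linear form in the kernel of `pairSq`. -/
noncomputable def linRel (i j : Fin n) : MvPolynomial (Fin n × Fin n × Bool) ℝ :=
  X (i, j, true) + X (i, j, false) - C 2 * (prodForm i i + prodForm j j)

/-- A quadratic form in the kernel of `pairSq`. -/
noncomputable def quadRel (i j k l : Fin n) : MvPolynomial (Fin n × Fin n × Bool) ℝ :=
  prodForm i j * prodForm k l - prodForm i k * prodForm j l

/-- A quartic form in the kernel of `pairSq` that is nonnegative, and vanishes on the simplex
only at points `((pᵢ ± pⱼ)²)`. -/
noncomputable def penalty (n : ℕ) : MvPolynomial (Fin n × Fin n × Bool) ℝ :=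
  (∑ t, X t) ^ 2 * ∑ i, ∑ j, linRel i j ^ 2 + ∑ i, ∑ j, ∑ k, ∑ l, quadRel i j k l ^ 2

lemma isHomogeneous_sum_X {τ : Type*} [Fintype τ] :
    (∑ t, X t : MvPolynomial τ ℝ).IsHomogeneous 1 :=
  IsHomogeneous.sum _ _ _ fun _ _ => isHomogeneous_X _ _

lemma isHomogeneous_penalty : (penalty n).IsHomogeneous 4 := by
  refine IsHomogeneous.add ?_ ?_
  · refine (isHomogeneous_sum_X.pow 2).mul (n := 2) ?_
    refine IsHomogeneous.sum _ _ _ fun i _ => IsHomogeneous.sum _ _ _ fun j _ => ?_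
    exact IsHomogeneous.pow (m := 1) (((isHomogeneous_X _ _).add (isHomogeneous_X _ _)).sub
      (((isHomogeneous_prodForm _ _).add (isHomogeneous_prodForm _ _)).C_mul _)) 2
  · refine IsHomogeneous.sum _ _ _ fun i _ => IsHomogeneous.sum _ _ _ fun j _ =>
      IsHomogeneous.sum _ _ _ fun k _ => IsHomogeneous.sum _ _ _ fun l _ => ?_
    exact IsHomogeneous.pow (m := 2)
      (((isHomogeneous_prodForm _ _).mul (isHomogeneous_prodForm _ _)).sub
        ((isHomogeneous_prodForm _ _).mul (isHomogeneous_prodForm _ _))) 2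

lemma pairSq_penalty : pairSq (penalty n) = 0 := by
  have h1 : ∀ i j : Fin n, pairSq (linRel i j) = 0 := fun i j => by
    rw [linRel, map_sub, map_mul, map_add, map_add, pairSq_prodForm, pairSq_prodForm, algHom_C,
      algebraMap_eq]
    simp only [pairSq, aeval_X, pairForm, cond_true, cond_false, map_ofNat]
    ring
  have h2 : ∀ i j k l : Fin n, pairSq (quadRel i j k l) = 0 := fun i j k l => by
    simp only [quadRel, map_sub, map_mul, pairSq_prodForm]
    ring
  simp [penalty, h1, h2]

lemma eval_penalty (z : Fin n × Fin n × Bool → ℝ) :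
    eval z (penalty n) = (∑ t, z t) ^ 2 * ∑ i, ∑ j, eval z (linRel i j) ^ 2 +
      ∑ i, ∑ j, ∑ k, ∑ l, eval z (quadRel i j k l) ^ 2 := by
  simp [penalty]

lemma eval_penalty_nonneg (z : Fin n × Fin n × Bool → ℝ) : 0 ≤ eval z (penalty n) := by
  rw [eval_penalty]
  positivity

lemma eval_eq_eval_pairSq {z : Fin n × Fin n × Bool → ℝ} {p : Fin n → ℝ}
    (h : ∀ t, z t = eval p (pairForm t) ^ 2) (P : MvPolynomial (Fin n × Fin n × Bool) ℝ) :
    eval z P = eval p (pairSq P) := by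
  have : (aeval z : MvPolynomial (Fin n × Fin n × Bool) ℝ →ₐ[ℝ] ℝ) = (aeval p).comp pairSq := by
    ext t
    simp [pairSq, h]
  exact DFunLike.congr_fun this P

lemma forall_eq_zero_of_sum_sq_eq_zero {a : Fin n → Fin n → ℝ}
    {b : Fin n → Fin n → Fin n → Fin n → ℝ}
    (h : ∑ i, ∑ j, a i j ^ 2 + ∑ i, ∑ j, ∑ k, ∑ l, b i j k l ^ 2 = 0) :
    (∀ i j, a i j = 0) ∧ ∀ i j k l, b i j k l = 0 := by
  have key : ∀ f : Fin n → ℝ, (∀ i, 0 ≤ f i) → ∑ i, f i = 0 → ∀ i, f i = 0 := fun f hf h i =>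
    (Finset.sum_eq_zero_iff_of_nonneg fun i _ => hf i).mp h i (Finset.mem_univ i)
  obtain ⟨h1, h2⟩ := (add_eq_zero_iff_of_nonneg (by positivity) (by positivity)).mp h
  refine ⟨fun i j => ?_, fun i j k l => ?_⟩
  · have h1 := key _ (fun _ => by positivity) h1 i
    exact pow_eq_zero_iff two_ne_zero |>.mp (key _ (fun _ => by positivity) h1 j)
  · have h2 := key _ (fun _ => by positivity) h2 i
    have h2 := key _ (fun _ => by positivity) h2 j
    have h2 := key _ (fun _ => by positivity) h2 k
    exact pow_eq_zero_iff two_ne_zero |>.mp (key _ (fun _ => by positivity) h2 l)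

lemma exists_eq_pairForm_sq_of_penalty_eq_zero {z : Fin n × Fin n × Bool → ℝ}
    (hz : ∑ t, z t = 1) (h : eval z (penalty n) = 0) :
    ∃ p : Fin n → ℝ, 4 * n * ∑ i, p i ^ 2 = 1 ∧ ∀ t, z t = eval p (pairForm t) ^ 2 := by
  rw [eval_penalty, hz, one_pow, one_mul] at h
  obtain ⟨hl, hq⟩ := forall_eq_zero_of_sum_sq_eq_zero h
  set x : Fin n → Fin n → ℝ := fun i j => eval z (prodForm i j) with hx
  have hxz : ∀ i j, 4 * x i j = z (i, j, true) - z (i, j, false) := fun i j => by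
    simp [hx, prodForm]
  have hl' : ∀ i j, z (i, j, true) + z (i, j, false) = 2 * (x i i + x j j) := fun i j => by
    have := hl i j
    simp only [linRel, map_sub, map_add, map_mul, eval_X, eval_C] at this
    linarith
  have hq' : ∀ i j k l, x i j * x k l = x i k * x j l := fun i j k l => by
    have := hq i j k l
    simp only [quadRel, map_sub, map_mul] at this
    linarith
  have htr : 4 * n * ∑ i, x i i = 1 := by
    rw [← hz, Fintype.sum_prod_type]
    simp only [Fintype.sum_prod_type, Fintype.sum_bool, hl']
    simp only [Finset.sum_add_distrib, ← Finset.mul_sum, Finset.sum_const, Finset.card_univ,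
      Fintype.card_fin, nsmul_eq_mul]
    ring
  obtain ⟨a, ha⟩ : ∃ a, 0 < x a a := by
    by_contra! hneg
    have : ∑ i, x i i ≤ 0 := Finset.sum_nonpos fun i _ => hneg i
    nlinarith [n.cast_nonneg (α := ℝ)]
  have hs : Real.sqrt (x a a) ^ 2 = x a a := Real.sq_sqrt ha.le
  have hs0 : Real.sqrt (x a a) ≠ 0 := (Real.sqrt_pos.mpr ha).ne'
  have hp : ∀ i j, x a i / Real.sqrt (x a a) * (x a j / Real.sqrt (x a a)) = x i j := by
    intro i j
    have := hq' a a i j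
    rw [div_mul_div_comm, ← sq, hs, div_eq_iff ha.ne']
    linarith
  refine ⟨fun i => x a i / Real.sqrt (x a a), ?_, ?_⟩
  · rw [← htr]
    simp only [sq, hp]
  · rintro ⟨i, j, b⟩
    have e1 := hxz i j
    have e2 := hl' i j
    have h1 := hp i i
    have h2 := hp i j
    have h3 := hp j j
    cases b <;> simp only [pairForm, cond_true, cond_false, map_add, map_sub, eval_X] <;> linarith

end Veronese

/-- A matrix version of **Reznick's theorem**, for matrices whose entries all have the same even
degree. -/
theorem exists_sumSqX_pow_smul_mem_sosCone {n d : ℕ} {ι : Type*} [Fintype ι]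
    (F : Matrix ι ι (MvPolynomial (Fin n) ℝ)) (hsymm : F.IsSymm)
    (hF : ∀ i j, (F i j).IsHomogeneous (2 * d)) (hn : n ≠ 0)
    (hpos : ∀ p : Fin n → ℝ, 4 * n * ∑ i, p i ^ 2 = 1 → ∀ x : ι → ℝ, x ≠ 0 →
      0 < x ⬝ᵥ (F.map (eval p)).mulVec x) :
    ∃ N : ℕ, sumSqX n ^ N • F ∈ sosCone ι (MvPolynomial (Fin n) ℝ) := by
  classical
  choose P₀ hP₀ hP₀F using fun i j => exists_pairSq_eq (hF i j)
  set P : Matrix ι ι (MvPolynomial (Fin n × Fin n × Bool) ℝ) :=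
    Matrix.of fun i j => C (1 / 2) * (P₀ i j + P₀ j i) with hPdef
  have hPsymm : P.IsSymm := by
    ext i j : 1
    simp [hPdef, add_comm]
  have hP : ∀ i j, (P i j).IsHomogeneous d := fun i j => ((hP₀ i j).add (hP₀ j i)).C_mul _
  have hPF : ∀ i j, pairSq (P i j) = F i j := fun i j => by
    have h : (C (1 / 2) : MvPolynomial (Fin n) ℝ) * 2 = 1 := by
      rw [← map_ofNat (C : ℝ →+* MvPolynomial (Fin n) ℝ), ← C_mul]; norm_num
    simp only [hPdef, Matrix.of_apply, map_mul, map_add, hP₀F, hsymm.apply i j, algHom_C,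
      algebraMap_eq]
    linear_combination F i j * h
  have hK : IsCompact (stdSimplex ℝ (Fin n × Fin n × Bool) ×ˢ {x : ι → ℝ | ∑ i, x i ^ 2 = 1}) :=
    (isCompact_stdSimplex ℝ _).prod (isCompact_sum_sq_eq 1)
  have hcont : ∀ q : MvPolynomial (Fin n × Fin n × Bool) ℝ,
      Continuous fun w : (Fin n × Fin n × Bool → ℝ) × (ι → ℝ) => eval w.1 q :=
    fun q => (continuous_eval q).comp continuous_fst
  obtain ⟨c, hc, hcpos⟩ := hK.exists_forall_pos_add_mul
    (f := fun w => w.2 ⬝ᵥ (P.map (eval w.1)).mulVec w.2) (g := fun w => eval w.1 (penalty n))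
    (by
      simp only [dotProduct_mulVec_eq_sum, Matrix.map_apply]
      refine continuous_finsetSum _ fun i _ => continuous_finsetSum _ fun j _ => ?_
      have := hcont (P i j)
      fun_prop)
    (hcont _) (fun w _ => eval_penalty_nonneg _)
    (fun w hw h0 => by
      obtain ⟨p, hp, hz⟩ := exists_eq_pairForm_sq_of_penalty_eq_zero hw.1.2 h0
      have : P.map (eval w.1) = F.map (eval p) := by
        ext i j : 1
        simp only [Matrix.map_apply, eval_eq_eval_pairSq hz, hPF]
      rw [this]
      refine hpos p hp _ fun h => ?_
      have := hw.2
      simp [h] at this)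
  set Q : Matrix ι ι (MvPolynomial (Fin n × Fin n × Bool) ℝ) :=
    (∑ t : Fin n × Fin n × Bool, X t : MvPolynomial (Fin n × Fin n × Bool) ℝ) ^ 4 • P +
      (C c * (∑ t : Fin n × Fin n × Bool, X t) ^ d * penalty n) • 1 with hQdef
  obtain ⟨N, hN⟩ := exists_posSemidef_coeff_of_pos_on_stdSimplex (e := d + 4) Q
    (by
      ext i j : 1
      simp [hQdef, hPsymm.apply i j, Matrix.one_apply, eq_comm])
    (fun i j => by
      simp only [hQdef, Matrix.add_apply, Matrix.smul_apply, smul_eq_mul]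
      refine IsHomogeneous.add ?_ ?_
      · have := ((isHomogeneous_sum_X (τ := Fin n × Fin n × Bool)).pow 4).mul (hP i j)
        rwa [one_mul, add_comm] at this
      · rw [Matrix.one_apply]
        split_ifs
        · have := (((isHomogeneous_sum_X (τ := Fin n × Fin n × Bool)).pow d).C_mul c).mul
            (isHomogeneous_penalty (n := n))
          rwa [one_mul, ← mul_one (_ * penalty n)] at this
        · rw [mul_zero]
          exact isHomogeneous_zero _ _ _)
    (fun z hz x hx => by
      refine quadForm_pos_of_unit (fun x hx => ?_) hx
      have h := hcpos (z, x) ⟨hz, hx⟩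
      have hQz : Q.map (eval z) = P.map (eval z) + (c * eval z (penalty n)) • 1 := by
        ext i j : 1
        simp [hQdef, hz.2, Matrix.one_apply, apply_ite (eval z)]
      rw [hQz, Matrix.add_mulVec, dotProduct_add, Matrix.smul_mulVec, Matrix.one_mulVec,
        dotProduct_smul]
      have h1 : x ⬝ᵥ x = 1 := by rw [← hx]; simp [dotProduct, sq]
      rw [h1]
      simpa using h)
  have hmem := map_aeval_sq_mem_sosCone hN pairForm
  have hmap : ((∑ t, X t : MvPolynomial (Fin n × Fin n × Bool) ℝ) ^ N • Q).map
      (aeval fun t => pairForm t ^ 2) =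
      (C ((4 * n : ℝ) ^ (N + 4)) : MvPolynomial (Fin n) ℝ) • sumSqX n ^ (N + 4) • F := by
    ext i j : 1
    have h1 : pairSq (((∑ t, X t : MvPolynomial (Fin n × Fin n × Bool) ℝ) ^ N • Q) i j) =
        (C (4 * n : ℝ) * sumSqX n) ^ N * ((C (4 * n : ℝ) * sumSqX n) ^ 4 * F i j) := by
      simp only [hQdef, Matrix.smul_apply, Matrix.add_apply, smul_eq_mul, map_mul, map_add,
        map_pow, pairSq_sum_X, pairSq_penalty, hPF]
      ring
    simp only [Matrix.map_apply, Matrix.smul_apply, smul_eq_mul]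
    rw [← pairSq]
    refine h1.trans ?_
    rw [C_pow]
    ring
  rw [hmap] at hmem
  refine ⟨N + 4, ?_⟩
  have hn' : (4 * n : ℝ) ^ (N + 4) ≠ 0 := by
    have : (n : ℝ) ≠ 0 := by exact_mod_cast hn
    positivity
  have := C_smul_mem_sosCone hmem (c := ((4 * n : ℝ) ^ (N + 4))⁻¹) (by positivity)
  rwa [smul_smul, ← C_mul, inv_mul_cancel₀ hn', C_1, one_smul] at this

section Twist

variable {n m : ℕ}

/-- The matrix with diagonal blocks the rows of all words of length `α i` in the variables. -/
noncomputable def wordMatrix (n : ℕ) {m : ℕ} (α : Fin m → ℕ) :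
    Matrix (Fin m) (Σ i : Fin m, Fin (α i) → Fin n) (MvPolynomial (Fin n) ℝ) :=
  Matrix.of fun i a => if a.1 = i then ∏ k, X (a.2 k) else 0

lemma wordMatrix_mul_transpose (α : Fin m → ℕ) :
    wordMatrix n α * (wordMatrix n α).transpose =
      Matrix.diagonal fun i => sumSqX n ^ α i := by
  ext i j : 1
  simp only [Matrix.mul_apply, Matrix.transpose_apply, wordMatrix, Matrix.of_apply,
    Fintype.sum_sigma, ite_mul, zero_mul, mul_ite, mul_zero, Finset.sum_ite_irrel,
    Finset.sum_const_zero, Finset.sum_ite_eq', Finset.mem_univ, if_true]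
  rw [Matrix.diagonal_apply, sumSqX, Fintype.sum_pow]
  simp only [eq_comm (a := j)]
  split_ifs with h
  · subst h
    simp only [← Finset.prod_mul_distrib, sq]
  · rfl

lemma transpose_wordMatrix_mul_mul_apply (α : Fin m → ℕ)
    (B : Matrix (Fin m) (Fin m) (MvPolynomial (Fin n) ℝ)) (a b : Σ i : Fin m, Fin (α i) → Fin n) :
    ((wordMatrix n α).transpose * B * wordMatrix n α) a b =
      (∏ k, X (a.2 k)) * B a.1 b.1 * ∏ k, X (b.2 k) := by
  simp [Matrix.mul_apply, wordMatrix, ite_mul, mul_ite]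

lemma isHomogeneous_prod_X {k : ℕ} (w : Fin k → Fin n) :
    (∏ j, X (w j) : MvPolynomial (Fin n) ℝ).IsHomogeneous k := by
  simpa using IsHomogeneous.prod (R := ℝ) Finset.univ (fun j => X (w j)) (fun _ => 1)
    fun j _ => isHomogeneous_X _ _

lemma sq_mulVec_wordMatrix_le (α : Fin m → ℕ) (p : Fin n → ℝ)
    (x : (Σ i : Fin m, Fin (α i) → Fin n) → ℝ) (i : Fin m) :
    ((wordMatrix n α).map (eval p)).mulVec x i ^ 2 ≤
      (∑ j, p j ^ 2) ^ α i * ∑ w : Fin (α i) → Fin n, x ⟨i, w⟩ ^ 2 := by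
  have h1 : ((wordMatrix n α).map (eval p)).mulVec x i =
      ∑ w : Fin (α i) → Fin n, (∏ k, p (w k)) * x ⟨i, w⟩ := by
    simp only [Matrix.mulVec, dotProduct, Matrix.map_apply, wordMatrix, Matrix.of_apply,
      Fintype.sum_sigma]
    rw [Finset.sum_eq_single i (fun b _ hb => by simp [hb])
      (fun h => absurd (Finset.mem_univ _) h)]
    simp
  have h2 : (∑ j, p j ^ 2) ^ α i = ∑ w : Fin (α i) → Fin n, (∏ k, p (w k)) ^ 2 := by
    simp only [Fintype.sum_pow, Finset.prod_pow]
  rw [h1, h2]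
  exact Finset.sum_mul_sq_le_sq_mul_sq _ _ _

/-- A matrix version of **Reznick's theorem**, for twisted homogeneous matrices. -/
theorem exists_sumSqX_pow_smul_mem_sosCone_of_isMatHomog {h : ℕ} (α : Fin m → ℕ)
    (F : Matrix (Fin m) (Fin m) (MvPolynomial (Fin n) ℝ)) (hsymm : F.IsSymm)
    (hF : IsMatHomog α (2 * h) F) (hα : ∀ i, α i ≤ h) (hn : n ≠ 0)
    (hpos : ∀ p : Fin n → ℝ, 4 * n * ∑ i, p i ^ 2 = 1 → ∀ x : Fin m → ℝ, x ≠ 0 →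
      0 < x ⬝ᵥ (F.map (eval p)).mulVec x) :
    ∃ N : ℕ, sumSqX n ^ N • F ∈ sosCone (Fin m) (MvPolynomial (Fin n) ℝ) := by
  classical
  set T := wordMatrix n α with hT
  set E : Matrix (Fin m) (Fin m) (MvPolynomial (Fin n) ℝ) :=
    Matrix.diagonal fun i => sumSqX n ^ (h - α i) with hE
  set G := T.transpose * (F - E) * T + sumSqX n ^ h • 1 with hG
  obtain ⟨N, hN⟩ := exists_sumSqX_pow_smul_mem_sosCone (d := h) G
    (by
      simp only [hG, hE, Matrix.IsSymm, Matrix.transpose_add, Matrix.transpose_mul,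
        Matrix.transpose_sub, Matrix.transpose_transpose, Matrix.diagonal_transpose, hsymm.eq,
        Matrix.transpose_smul, Matrix.transpose_one, Matrix.mul_assoc])
    (fun a b => by
      simp only [hG, Matrix.add_apply, hT, transpose_wordMatrix_mul_mul_apply, Matrix.smul_apply,
        smul_eq_mul]
      have ha := hα a.1
      have hb := hα b.1
      refine IsHomogeneous.add ?_ ?_
      · have hFE : ((F - E) a.1 b.1).IsHomogeneous (2 * h - α a.1 - α b.1) := by
          refine (hF a.1 b.1).1.sub ?_
          rw [hE, Matrix.diagonal_apply]
          split_ifs with hab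
          · have := (isHomogeneous_sumSqX (n := n)).pow (h - α a.1)
            rwa [show 2 * (h - α a.1) = 2 * h - α a.1 - α b.1 by rw [← hab]; omega] at this
          · exact isHomogeneous_zero _ _ _
        have := ((isHomogeneous_prod_X a.2).mul hFE).mul (isHomogeneous_prod_X b.2)
        rwa [show α a.1 + (2 * h - α a.1 - α b.1) + α b.1 = 2 * h by omega] at this
      · rw [Matrix.one_apply]
        split_ifs
        · rw [mul_one]
          exact isHomogeneous_sumSqX.pow h
        · rw [mul_zero]
          exact isHomogeneous_zero _ _ _)
    hn
    (fun p hp x hx => by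
      set r := ∑ i, p i ^ 2 with hr
      have hr0 : 0 < r := by
        by_contra! hneg
        nlinarith [n.cast_nonneg (α := ℝ)]
      have hGp : G.map (eval p) = (T.map (eval p)).transpose *
          (F.map (eval p) - Matrix.diagonal fun i => r ^ (h - α i)) * T.map (eval p) +
            r ^ h • 1 := by
        have h1 : E.map (eval p) = Matrix.diagonal fun i => r ^ (h - α i) := by
          rw [hE, Matrix.diagonal_map (map_zero _)]
          simp [eval_sumSqX, hr]
        have h2 : (sumSqX n ^ h • 1 : Matrix (Σ i : Fin m, Fin (α i) → Fin n)
            (Σ i : Fin m, Fin (α i) → Fin n) (MvPolynomial (Fin n) ℝ)).map (eval p) = r ^ h • 1 := by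
          ext a b : 1
          simp [Matrix.one_apply, eval_sumSqX, hr, apply_ite (eval p)]
        rw [hG, Matrix.map_add _ (map_add _), Matrix.map_mul, Matrix.map_mul,
          Matrix.map_sub _ (map_sub _), h1, h2, Matrix.transpose_map]
      set y := (T.map (eval p)).mulVec x with hy
      have hform : x ⬝ᵥ (G.map (eval p)).mulVec x = y ⬝ᵥ (F.map (eval p)).mulVec y -
          ∑ i, r ^ (h - α i) * y i ^ 2 + r ^ h * ∑ a, x a ^ 2 := by
        rw [hGp, Matrix.add_mulVec, dotProduct_add, Matrix.smul_mulVec, Matrix.one_mulVec,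
          dotProduct_smul, ← Matrix.mulVec_mulVec, ← Matrix.mulVec_mulVec, ← hy,
          Matrix.dotProduct_mulVec, Matrix.vecMul_transpose, ← hy, Matrix.sub_mulVec,
          dotProduct_sub]
        simp only [dotProduct, Matrix.mulVec_diagonal, smul_eq_mul, sq, mul_left_comm]
      have hle : ∑ i, r ^ (h - α i) * y i ^ 2 ≤ r ^ h * ∑ a, x a ^ 2 := by
        rw [Fintype.sum_sigma, Finset.mul_sum]
        refine Finset.sum_le_sum fun i _ => ?_
        calc r ^ (h - α i) * y i ^ 2
            ≤ r ^ (h - α i) * (r ^ α i * ∑ w : Fin (α i) → Fin n, x ⟨i, w⟩ ^ 2) := by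
              gcongr
              exact sq_mulVec_wordMatrix_le α p x i
          _ = r ^ h * ∑ w : Fin (α i) → Fin n, x ⟨i, w⟩ ^ 2 := by
              rw [← mul_assoc, ← pow_add, Nat.sub_add_cancel (hα i)]
      rw [hform]
      by_cases hy0 : y = 0
      · obtain ⟨a, ha⟩ := Function.ne_iff.mp hx
        have ha : x a ≠ 0 := ha
        have : 0 < ∑ a, x a ^ 2 :=
          Finset.sum_pos' (fun _ _ => sq_nonneg _) ⟨a, Finset.mem_univ _, by positivity⟩
        simp only [hy0, zero_dotProduct, Pi.zero_apply, ne_eq, OfNat.ofNat_ne_zero,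
          not_false_eq_true, zero_pow, mul_zero, Finset.sum_const_zero, sub_zero, zero_add]
        positivity
      · have := hpos p hp y hy0
        linarith)
  have hTT : T * T.transpose = Matrix.diagonal fun i => sumSqX n ^ α i :=
    wordMatrix_mul_transpose α
  have hTE : T * (T.transpose * E) = sumSqX n ^ h • 1 := by
    rw [← Matrix.mul_assoc, hTT, hE, Matrix.diagonal_mul_diagonal, ← Matrix.diagonal_one,
      ← Matrix.diagonal_smul]
    congr 1
    ext i : 1
    simp only [Pi.smul_apply, smul_eq_mul, mul_one, ← pow_add]
    rw [Nat.add_sub_cancel' (hα i)]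
  have hET : E * T * T.transpose = sumSqX n ^ h • 1 := by
    rw [Matrix.mul_assoc, hTT, hE, Matrix.diagonal_mul_diagonal, ← Matrix.diagonal_one,
      ← Matrix.diagonal_smul]
    congr 1
    ext i : 1
    simp only [Pi.smul_apply, smul_eq_mul, mul_one, ← pow_add]
    rw [Nat.sub_add_cancel (hα i)]
  have hconj : (T.transpose * E).transpose * G * (T.transpose * E) = sumSqX n ^ (2 * h) • F := by
    have hEt : (T.transpose * E).transpose = E * T := by
      rw [Matrix.transpose_mul, Matrix.transpose_transpose, hE, Matrix.diagonal_transpose]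
    rw [hEt, hG, Matrix.mul_add, Matrix.add_mul]
    have h1 : E * T * (T.transpose * (F - E) * T) * (T.transpose * E) =
        (E * T * T.transpose) * (F - E) * (T * (T.transpose * E)) := by
      simp only [Matrix.mul_assoc]
    have h2 : E * T * (sumSqX n ^ h • (1 : Matrix (Σ i : Fin m, Fin (α i) → Fin n)
        (Σ i : Fin m, Fin (α i) → Fin n) (MvPolynomial (Fin n) ℝ))) * (T.transpose * E) =
        sumSqX n ^ h • ((E * T * T.transpose) * E) := by
      rw [Matrix.mul_smul, Matrix.smul_mul, Matrix.mul_one, Matrix.mul_assoc (E * T)]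
    rw [h1, h2, hET, hTE]
    simp only [Matrix.mul_smul, Matrix.smul_mul, Matrix.mul_one, Matrix.one_mul, smul_smul,
      smul_sub, ← pow_add, two_mul]
    abel
  have := transpose_mul_mul_mem_sosCone hN (T.transpose * E)
  rw [Matrix.mul_smul, Matrix.smul_mul, hconj, smul_smul, ← pow_add] at this
  exact ⟨_, this⟩

end Twist

section Generators

variable {n m : ℕ}

lemma exists_prod_X_dvd_monomial (k : ℕ) : ∀ s : Fin n →₀ ℕ, k ≤ s.degree →
    ∃ w : Fin k → Fin n, (∏ j, X (w j)) ∣ (monomial s 1 : MvPolynomial (Fin n) ℝ) := by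
  induction k with
  | zero => exact fun s _ => ⟨Fin.elim0, by simp⟩
  | succ k ih =>
    intro s hs
    obtain ⟨i, s', hs', h⟩ := exists_monomial_eq_X_mul s (k := s.degree - 1) (by omega)
    obtain ⟨w, hw⟩ := ih s' (by omega)
    refine ⟨Fin.cons i w, ?_⟩
    rw [h, Fin.prod_univ_succ]
    simpa using mul_dvd_mul_left (X i) hw

lemma isSOS_C_mul_sumSqX_pow {c : ℝ} (hc : 0 ≤ c) (N : ℕ) : IsSOS (C c * sumSqX n ^ N) := by
  refine ⟨Fintype.card (Fin N → Fin n), fun i =>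
    C (Real.sqrt c) * ∏ j, X ((Fintype.equivFin (Fin N → Fin n)).symm i j), ?_⟩
  rw [(Fintype.equivFin (Fin N → Fin n)).symm.sum_comp
    fun w : Fin N → Fin n => (C (Real.sqrt c) * ∏ j, X (w j) : MvPolynomial (Fin n) ℝ) ^ 2]
  simp only [mul_pow, ← C_pow, Real.sq_sqrt hc, ← Finset.mul_sum, sumSqX, Fintype.sum_pow,
    Finset.prod_pow]

lemma sumSqX_pow_smul_single_sub_mem_sosCone {k : ℕ} (w : Fin k → Fin n) (i : Fin m) :
    sumSqX n ^ k • Matrix.single i i 1 -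
      Matrix.vecMulVec (Pi.single i (∏ j, X (w j))) (Pi.single i (∏ j, X (w j))) ∈
        sosCone (Fin m) (MvPolynomial (Fin n) ℝ) := by
  classical
  have h : sumSqX n ^ k • Matrix.single i i (1 : MvPolynomial (Fin n) ℝ) =
      ∑ v : Fin k → Fin n,
        Matrix.vecMulVec (Pi.single i (∏ j, X (v j))) (Pi.single i (∏ j, X (v j))) := by
    ext a b : 1
    simp only [Matrix.smul_apply, Matrix.sum_apply, Matrix.vecMulVec_apply, Matrix.single_apply,
      Pi.single_apply, sumSqX, Fintype.sum_pow, Finset.prod_pow, smul_eq_mul]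
    by_cases ha : a = i <;> by_cases hb : b = i <;> simp [ha, hb, eq_comm (a := i), sq]
  rw [h, ← Finset.add_sum_erase _ _ (Finset.mem_univ w), add_sub_cancel_left]
  exact sum_mem fun v _ => vecMulVec_mem_sosCone _

lemma IsMatHomog.exists_eq_two_mul {α : Fin m → ℕ} {D : ℕ}
    {Λ : Matrix (Fin m) (Fin m) (MvPolynomial (Fin n) ℝ)} (hΛ : IsMatHomog α D Λ)
    (hpd : ∀ p : Fin n → ℝ, p ≠ 0 → (Λ.map (eval p)).PosDef) (hn : n ≠ 0) (i : Fin m) :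
    ∃ h, D = 2 * h ∧ α i ≤ h := by
  have hpos : ∀ p : Fin n → ℝ, p ≠ 0 → 0 < eval p (Λ i i) := fun p hp => (hpd p hp).diag_pos
  set p : Fin n → ℝ := fun _ => 1
  have hp : p ≠ 0 := fun h => by simpa [p] using congrFun h ⟨0, Nat.pos_of_ne_zero hn⟩
  have hle : α i + α i ≤ D := by
    by_contra! hlt
    have := hpos p hp
    rw [(hΛ i i).2 hlt] at this
    simp at this
  have hneg : eval (-p) (Λ i i) = (-1) ^ (D - α i - α i) * eval p (Λ i i) := by
    rw [eval_eq', eval_eq', Finset.mul_sum]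
    refine Finset.sum_congr rfl fun s hs => ?_
    have hd : D - α i - α i = ∑ j, s j := by
      rw [(hΛ i i).1.degree_eq_sum_deg_support hs]
      exact Finset.sum_subset (Finset.subset_univ _) fun j _ hj => by simpa using hj
    rw [hd, ← Finset.prod_pow_eq_pow_sum, mul_left_comm, ← Finset.prod_mul_distrib]
    simp [p]
  rcases Nat.even_or_odd (D - α i - α i) with ⟨k, hk⟩ | hodd
  · exact ⟨k + α i, by omega, by omega⟩
  · have h1 := hpos p hp
    have h2 := hpos (-p) (neg_ne_zero.mpr hp)
    rw [hneg, hodd.neg_one_pow] at h2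
    linarith

/-- For each index `i`, all vectors `M eᵢ` with `M` a product of `k` variables are among the
generators of `Σ(Λ)`, for some `k`. -/
lemma exists_single_prod_X_mem_sigmaMod {α : Fin m → ℕ} {h : ℕ}
    {Λ : Matrix (Fin m) (Fin m) (MvPolynomial (Fin n) ℝ)} (hsymm : Λ.IsSymm)
    (hΛ : IsMatHomog α (2 * h) Λ)
    (hpd : ∀ p : Fin n → ℝ, p ≠ 0 → (Λ.map (eval p)).PosDef) (hn : n ≠ 0)
    (hα : ∀ i, α i ≤ h) (i : Fin m) :
    ∃ k, ∀ w : Fin k → Fin n, Pi.single i (∏ j, X (w j)) ∈ SigmaMod α Λ := by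
  classical
  have hn' : (0 : ℝ) < n := by exact_mod_cast Nat.pos_of_ne_zero hn
  have hpt : ∀ p : Fin n → ℝ, 4 * n * ∑ i, p i ^ 2 = 1 → p ≠ 0 := by
    rintro p hp rfl
    simp at hp
  have hK : IsCompact ({p : Fin n → ℝ | ∑ i, p i ^ 2 = 1 / (4 * n)} ×ˢ
      {x : Fin m → ℝ | ∑ i, x i ^ 2 = 1}) :=
    (isCompact_sum_sq_eq _).prod (isCompact_sum_sq_eq 1)
  have hcont : ∀ q : MvPolynomial (Fin n) ℝ,
      Continuous fun w : (Fin n → ℝ) × (Fin m → ℝ) => eval w.1 q :=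
    fun q => (continuous_eval q).comp continuous_fst
  have hpos : ∀ w ∈ {p : Fin n → ℝ | ∑ i, p i ^ 2 = 1 / (4 * n)} ×ˢ
      {x : Fin m → ℝ | ∑ i, x i ^ 2 = 1}, 0 < w.2 ⬝ᵥ (Λ.map (eval w.1)).mulVec w.2 := by
    intro w hw
    have h1 : w.1 ≠ 0 := hpt _ (by rw [Set.mem_ofPred_eq.mp hw.1]; field_simp)
    have h2 : w.2 ≠ 0 := fun h => by
      have := hw.2
      simp [h] at this
    simpa using (hpd _ h1).dotProduct_mulVec_pos h2
  obtain ⟨c, hc, hcpos⟩ := hK.exists_forall_pos_add_mul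
    (f := fun w => -(eval w.1 (sumSqX n ^ (h - α i)) * w.2 i ^ 2))
    (g := fun w => w.2 ⬝ᵥ (Λ.map (eval w.1)).mulVec w.2)
    (by
      have := hcont (sumSqX n ^ (h - α i))
      fun_prop)
    (by
      simp only [dotProduct_mulVec_eq_sum, Matrix.map_apply]
      refine continuous_finsetSum _ fun i _ => continuous_finsetSum _ fun j _ => ?_
      have := hcont (Λ i j)
      fun_prop)
    (fun w hw => (hpos w hw).le)
    (fun w hw h0 => absurd h0 (hpos w hw).ne')
  obtain ⟨N, hN⟩ := exists_sumSqX_pow_smul_mem_sosCone_of_isMatHomog (h := h) α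
    ((C c : MvPolynomial (Fin n) ℝ) • Λ - sumSqX n ^ (h - α i) • Matrix.single i i 1)
    (by
      simp [Matrix.IsSymm, Matrix.transpose_sub, Matrix.transpose_smul, hsymm.eq,
        Matrix.transpose_single])
    (fun a b => by
      have ha := hα a
      have hb := hα b
      refine ⟨?_, fun hlt => by omega⟩
      simp only [Matrix.sub_apply, Matrix.smul_apply, smul_eq_mul, Matrix.single_apply]
      refine ((hΛ a b).1.C_mul c).sub ?_
      split_ifs with hab
      · have := (isHomogeneous_sumSqX (n := n)).pow (h - α i)
        rw [mul_one]
        rwa [show 2 * (h - α i) = 2 * h - α a - α b by rw [← hab.1, ← hab.2]; omega] at this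
      · rw [mul_zero]
        exact isHomogeneous_zero _ _ _)
    hα hn
    (fun p hp x hx => by
      refine quadForm_pos_of_unit (fun x hx => ?_) hx
      have h1 := hcpos (p, x) ⟨by rw [Set.mem_ofPred_eq]; field_simp; linarith, hx⟩
      have h2 : ((C c : MvPolynomial (Fin n) ℝ) • Λ -
          sumSqX n ^ (h - α i) • Matrix.single i i 1).map (eval p) =
          c • Λ.map (eval p) - eval p (sumSqX n ^ (h - α i)) • Matrix.single i i 1 := by
        ext a b : 1
        simp [Matrix.single_apply, apply_ite (eval p)]
      have h3 : x ⬝ᵥ (Matrix.single i i (1 : ℝ)).mulVec x = x i ^ 2 := by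
        simp [dotProduct_mulVec_eq_sum, Matrix.single_apply, sq, ite_and]
      rw [h2, Matrix.sub_mulVec, dotProduct_sub, Matrix.smul_mulVec, Matrix.smul_mulVec,
        dotProduct_smul, dotProduct_smul, h3, smul_eq_mul, smul_eq_mul]
      simp only at h1
      linarith)
  refine ⟨N + (h - α i), fun w => Submodule.subset_span ⟨⟨N + (h - α i) + α i, fun j => ?_⟩,
    C c * sumSqX n ^ N, 2 * N, isSOS_C_mul_sumSqX_pow hc N,
    (isHomogeneous_sumSqX.pow N).C_mul c, ?_⟩⟩
  · by_cases hj : j = i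
    · subst hj
      rw [Pi.single_eq_same]
      refine ⟨?_, fun h => by omega⟩
      rw [Nat.add_sub_cancel]
      exact isHomogeneous_prod_X w
    · rw [Pi.single_eq_of_ne hj]
      exact ⟨isHomogeneous_zero _ _ _, fun _ => rfl⟩
  · obtain ⟨s, v, hv⟩ := exists_eq_sum_of_mem_sosCone
      (add_mem hN (sumSqX_pow_smul_single_sub_mem_sosCone w i))
    refine ⟨s, v, ?_⟩
    rw [← hv, smul_sub, smul_smul, smul_smul, ← pow_add, mul_comm (C c)]
    abel

end Generators

/-- **Theorem.** Let `Λ` be a symmetric homogeneous `m×m` matrix over `R = ℝ[x₁,…,xₙ]`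
which is positive definite. Then `R_{≥k} ⊆ (Σ(Λ) : R^m)` for some `k`, i.e. `a·u ∈ Σ(Λ)`
for every `a ∈ R` all of whose nonzero homogeneous components have degree `≥ k` and every
`u ∈ R^m`. -/
theorem statement14 {n m : ℕ} (hm : 1 ≤ m) (α : Fin m → ℕ) (D : ℕ)
    (Λ : Matrix (Fin m) (Fin m) (MvPolynomial (Fin n) ℝ)) (hsymm : Λ.IsSymm)
    (hΛ : IsMatHomog α D Λ)
    (hpd : ∀ p : Fin n → ℝ, p ≠ 0 → (Λ.map (eval p)).PosDef) :
    ∃ k : ℕ, ∀ a : MvPolynomial (Fin n) ℝ, (∀ i < k, homogeneousComponent i a = 0) →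
      ∀ u : Fin m → MvPolynomial (Fin n) ℝ, a • u ∈ SigmaMod α Λ := by
  rcases eq_or_ne n 0 with rfl | hn
  · refine ⟨1, fun a ha u => ?_⟩
    have h0 := ha 0 one_pos
    rw [homogeneousComponent_eq_self (isHomogeneous_of_isEmpty _ _ a)] at h0
    rw [h0, zero_smul]
    exact zero_mem _
  obtain ⟨h, rfl, -⟩ := hΛ.exists_eq_two_mul hpd hn ⟨0, hm⟩
  have hα : ∀ i, α i ≤ h := fun i => by
    obtain ⟨h', hh', hi⟩ := hΛ.exists_eq_two_mul hpd hn i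
    omega
  choose k hk using fun i => exists_single_prod_X_mem_sigmaMod hsymm hΛ hpd hn hα i
  refine ⟨∑ i, k i, fun a ha u => ?_⟩
  have hu : a • u = ∑ i, u i • (Pi.single i a : Fin m → MvPolynomial (Fin n) ℝ) := by
    ext1 j
    simp [Finset.sum_apply, Pi.single_apply, mul_comm]
  rw [hu]
  refine sum_mem fun i _ => Submodule.smul_mem _ _ ?_
  have ha' : (Pi.single i a : Fin m → MvPolynomial (Fin n) ℝ) =
      ∑ s ∈ a.support, (C (coeff s a) : MvPolynomial (Fin n) ℝ) • Pi.single i (monomial s 1) := by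
    conv_lhs => rw [a.as_sum]
    simp only [← Pi.single_smul, smul_eq_mul, C_mul_monomial, mul_one]
    exact map_sum (AddMonoidHom.single (fun _ : Fin m => MvPolynomial (Fin n) ℝ) i) _ _
  rw [ha']
  refine sum_mem fun s hs => Submodule.smul_mem _ _ ?_
  have hdeg : k i ≤ s.degree := by
    refine (Finset.single_le_sum (f := k) (fun _ _ => Nat.zero_le _) (Finset.mem_univ i)).trans ?_
    by_contra! hlt
    have := congrArg (coeff s) (ha _ hlt)
    rw [coeff_homogeneousComponent, if_pos rfl, coeff_zero] at this
    exact mem_support_iff.mp hs this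
  obtain ⟨w, b, hw⟩ := exists_prod_X_dvd_monomial (k i) s hdeg
  rw [hw, mul_comm, ← smul_eq_mul, Pi.single_smul]
  exact Submodule.smul_mem _ _ (hk i w)
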